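/- Let G be a finite simple very well-covered graph and let S be a stable set in G. Then S is a local maximum stable set of G (i.e., S ∈ Ψ(G)) if and only if |S| = |N(S)|. -/

import Mathlib

open Classical

variable {V : Type*} [Fintype V] [DecidableEq V]

/-- `S` is a stable (independent) set of vertices in `G`. -/
def IsStable (G : SimpleGraph V) (S : Finset V) : Prop :=
  ∀ ⦃x⦄, x ∈ S → ∀ ⦃y⦄, y ∈ S → ¬G.Adj x y

/-- The open neighborhood `N(S)`: vertices outside `S` having a neighbor in `S`. -/
noncomputable def nbhd (G : SimpleGraph V) (S : Finset V) : Finset V :=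
  Finset.univ.filter fun v => v ∉ S ∧ ∃ u ∈ S, G.Adj u v

/-- The closed neighborhood `N[S] = S ∪ N(S)`. -/
noncomputable def closedNbhd (G : SimpleGraph V) (S : Finset V) : Finset V :=
  S ∪ nbhd G S

/-- The stability (independence) number of the subgraph of `G` induced by `A`. -/
noncomputable def alphaOn (G : SimpleGraph V) (A : Finset V) : ℕ :=
  sSup {n | ∃ S ⊆ A, IsStable G S ∧ S.card = n}

/-- The stability (independence) number `α(G)`. -/
noncomputable def alpha (G : SimpleGraph V) : ℕ :=
  alphaOn G Finset.univ

/-- `S` is a maximum stable set of the subgraph of `G` induced by `N[S]`. -/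
def IsLocalMaxStable (G : SimpleGraph V) (S : Finset V) : Prop :=
  IsStable G S ∧ S.card = alphaOn G (closedNbhd G S)

/-- `Ψ(G)`: the family of all local maximum stable sets of `G`. -/
def Psi (G : SimpleGraph V) : Set (Finset V) :=
  {S | IsLocalMaxStable G S}

/-- A matching of `G`: a set of pairwise disjoint edges of `G`. -/
def IsGMatching (G : SimpleGraph V) (M : Finset (Sym2 V)) : Prop :=
  (∀ e ∈ M, e ∈ G.edgeSet) ∧
    ∀ e ∈ M, ∀ f ∈ M, e ≠ f → ∀ v : V, v ∈ e → v ∉ f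

/-- A matching of `G` all of whose edges have both endpoints inside `A`,
i.e. a matching of the subgraph of `G` induced by `A`. -/
def IsGMatchingOn (G : SimpleGraph V) (A : Finset V) (M : Finset (Sym2 V)) : Prop :=
  IsGMatching G M ∧ ∀ e ∈ M, ∀ v : V, v ∈ e → v ∈ A

/-- The matching number of the subgraph of `G` induced by `A`. -/
noncomputable def muOn (G : SimpleGraph V) (A : Finset V) : ℕ :=
  sSup {n | ∃ M, IsGMatchingOn G A M ∧ M.card = n}

/-- The matching number `μ(G)`. -/
noncomputable def mu (G : SimpleGraph V) : ℕ :=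
  muOn G Finset.univ

/-- A maximum matching of `G`. -/
def IsMaximumGMatching (G : SimpleGraph V) (M : Finset (Sym2 V)) : Prop :=
  IsGMatching G M ∧ M.card = mu G

/-- The matching `M` saturates the vertex `v`. -/
def MSaturates (M : Finset (Sym2 V)) (v : V) : Prop :=
  ∃ e ∈ M, v ∈ e

/-- A perfect matching of `G`: a matching saturating every vertex. -/
def IsPerfectGMatching (G : SimpleGraph V) (M : Finset (Sym2 V)) : Prop :=
  IsGMatching G M ∧ ∀ v : V, MSaturates M v

/-- The set of vertices saturated by `M`. -/
noncomputable def msupp (M : Finset (Sym2 V)) : Finset V :=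
  Finset.univ.filter fun v => ∃ e ∈ M, v ∈ e

/-- `M` is a uniquely restricted matching: it is the unique perfect matching of
the subgraph of `G` induced by the set of vertices saturated by `M`. -/
def UniquelyRestricted (G : SimpleGraph V) (M : Finset (Sym2 V)) : Prop :=
  IsGMatching G M ∧
    ∀ M' : Finset (Sym2 V), IsGMatchingOn G (msupp M) M' →
      (∀ v ∈ msupp M, MSaturates M' v) → M' = M

/-- Accessibility property of a set system. -/
def AccessibleFam (F : Set (Finset V)) : Prop :=
  ∀ X ∈ F, X ≠ ∅ → ∃ x ∈ X, X.erase x ∈ F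

/-- Exchange property of a set system. -/
def ExchangeFam (F : Set (Finset V)) : Prop :=
  ∀ X ∈ F, ∀ Y ∈ F, X.card = Y.card + 1 → ∃ x ∈ X, x ∉ Y ∧ insert x Y ∈ F

/-- A greedoid: a nonempty set system satisfying accessibility and exchange. -/
def IsGreedoidFam (F : Set (Finset V)) : Prop :=
  F.Nonempty ∧ AccessibleFam F ∧ ExchangeFam F

/-- A maximal stable set. -/
def IsMaximalStable (G : SimpleGraph V) (S : Finset V) : Prop :=
  IsStable G S ∧ ∀ T, IsStable G T → S ⊆ T → S = T

/-- `G` is well-covered: all maximal stable sets have the same cardinality. -/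
def WellCovered (G : SimpleGraph V) : Prop :=
  ∀ S T, IsMaximalStable G S → IsMaximalStable G T → S.card = T.card

/-- `G` is very well-covered: well-covered, no isolated vertices, `|V| = 2α(G)`. -/
def VeryWellCovered (G : SimpleGraph V) : Prop :=
  WellCovered G ∧ (∀ v : V, ∃ u, G.Adj v u) ∧ Fintype.card V = 2 * alpha G

/-- The subgraph of `G` induced by `A` is a König-Egerváry graph. -/
def KonigEgervaryOn (G : SimpleGraph V) (A : Finset V) : Prop :=
  alphaOn G A + muOn G A = A.card

/-- `G` is a König-Egerváry graph: `α(G) + μ(G) = |V(G)|`. -/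
def KonigEgervary (G : SimpleGraph V) : Prop :=
  alpha G + mu G = Fintype.card V

/-- The cycle `c` is alternating with respect to `M`: of every two incident
edges of `c` exactly one belongs to `M`. -/
def IsAlternatingCycle (G : SimpleGraph V) (M : Finset (Sym2 V)) {v : V}
    (c : G.Walk v v) : Prop :=
  c.IsCycle ∧ ∀ e ∈ c.edges, ∀ f ∈ c.edges, e ≠ f →
    (∃ u : V, u ∈ e ∧ u ∈ f) → (e ∈ M ↔ f ∉ M)

/-- `G` contains an `M`-alternating cycle. -/
def HasAlternatingCycle (G : SimpleGraph V) (M : Finset (Sym2 V)) : Prop :=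
  ∃ (v : V) (c : G.Walk v v), IsAlternatingCycle G M c

/-- The cycle `c` is chordless: the subgraph induced by its vertices has no
edges other than the cycle edges. -/
def ChordlessCycle (G : SimpleGraph V) {v : V} (c : G.Walk v v) : Prop :=
  ∀ x ∈ c.support, ∀ y ∈ c.support, G.Adj x y → s(x, y) ∈ c.edges

theorem mem_nbhd {G : SimpleGraph V} {S : Finset V} {v : V} :
    v ∈ nbhd G S ↔ v ∉ S ∧ ∃ u ∈ S, G.Adj u v := by
  simp [nbhd]

theorem IsStable.subset {G : SimpleGraph V} {S T : Finset V} (hT : IsStable G T) (h : S ⊆ T) :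
    IsStable G S :=
  fun _ hx _ hy => hT (h hx) (h hy)

theorem IsStable.card_le_alphaOn {G : SimpleGraph V} {S A : Finset V} (hS : IsStable G S)
    (hSA : S ⊆ A) : S.card ≤ alphaOn G A :=
  le_csSup ⟨Fintype.card V, by rintro _ ⟨T, -, -, rfl⟩; exact T.card_le_univ⟩ ⟨S, hSA, hS, rfl⟩

theorem exists_isStable_card_eq_alphaOn (G : SimpleGraph V) (A : Finset V) :
    ∃ S ⊆ A, IsStable G S ∧ S.card = alphaOn G A :=
  Nat.sSup_mem (s := {n | ∃ S ⊆ A, IsStable G S ∧ S.card = n})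
    ⟨0, ∅, by simp, by simp [IsStable], rfl⟩
    ⟨Fintype.card V, by rintro _ ⟨T, -, -, rfl⟩; exact T.card_le_univ⟩

theorem IsStable.exists_isMaximalStable {G : SimpleGraph V} {S : Finset V} (hS : IsStable G S) :
    ∃ W, S ⊆ W ∧ IsMaximalStable G W := by
  obtain ⟨W, hSW, hW⟩ := (Set.toFinite {T | IsStable G T}).exists_le_maximal hS
  exact ⟨W, hSW, hW.prop, fun T hT h => hW.eq_of_le hT h⟩

theorem WellCovered.card_eq_alpha {G : SimpleGraph V} (hG : WellCovered G) {W : Finset V}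
    (hW : IsMaximalStable G W) : W.card = alpha G := by
  obtain ⟨S, -, hS, hcard⟩ := exists_isStable_card_eq_alphaOn G Finset.univ
  obtain ⟨T, hST, hT⟩ := hS.exists_isMaximalStable
  rw [hG W T hW hT]
  exact le_antisymm (hT.1.card_le_alphaOn (Finset.subset_univ _))
    (hcard.symm.le.trans (Finset.card_le_card hST))

/-- Exchanging part of a maximum stable set `Y` for a disjoint stable set `A`. -/
theorem IsStable.card_le_card_nbhd_inter {G : SimpleGraph V} {A Y : Finset V}
    (hA : IsStable G A) (hY : IsStable G Y) (hcard : Y.card = alpha G) (hAY : Disjoint A Y) :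
    A.card ≤ (nbhd G A ∩ Y).card := by
  have hstable : IsStable G (A ∪ (Y \ nbhd G A)) := by
    have key : ∀ x ∈ A, ∀ y ∈ Y \ nbhd G A, ¬G.Adj x y := fun x hx y hy hxy =>
      (Finset.mem_sdiff.1 hy).2 (mem_nbhd.2
        ⟨fun h => Finset.disjoint_left.1 hAY h (Finset.mem_sdiff.1 hy).1, x, hx, hxy⟩)
    intro x hx y hy hxy
    rcases Finset.mem_union.1 hx with hx | hx <;> rcases Finset.mem_union.1 hy with hy | hy
    · exact hA hx hy hxy
    · exact key x hx y hy hxy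
    · exact key y hy x hx hxy.symm
    · exact hY (Finset.mem_sdiff.1 hx).1 (Finset.mem_sdiff.1 hy).1 hxy
  have hle : _ ≤ alpha G := hstable.card_le_alphaOn (Finset.subset_univ _)
  rw [Finset.card_union_of_disjoint (hAY.mono_right Finset.sdiff_subset)] at hle
  have := Finset.card_sdiff_add_card_inter Y (nbhd G A)
  rw [Finset.inter_comm] at this
  omega

/-- In a well-covered graph without isolated vertices, stable sets satisfy Hall's condition. -/
theorem WellCovered.card_le_card_nbhd {G : SimpleGraph V} (hG : WellCovered G)
    (hiso : ∀ v : V, ∃ u, G.Adj v u) {A : Finset V} (hA : IsStable G A) :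
    A.card ≤ (nbhd G A).card := by
  induction A using Finset.strongInduction with
  | H A ih =>
    obtain rfl | ⟨a, ha⟩ := A.eq_empty_or_nonempty
    · simp
    obtain ⟨v, hav⟩ := hiso a
    obtain ⟨Y, hvY, hY⟩ := IsStable.exists_isMaximalStable (G := G) (S := {v})
      (by simp [IsStable])
    have hvY : v ∈ Y := hvY (Finset.mem_singleton_self v)
    have haY : a ∉ Y := fun h => hY.1 h hvY hav
    have h1 := ih (A ∩ Y) (Finset.ssubset_iff_of_subset Finset.inter_subset_left |>.2
      ⟨a, ha, fun h => haY (Finset.mem_inter.1 h).2⟩) (hA.subset Finset.inter_subset_left)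
    have h2 := (hA.subset (Finset.sdiff_subset (t := Y))).card_le_card_nbhd_inter hY.1
      (hG.card_eq_alpha hY) Finset.sdiff_disjoint
    have hdisj : Disjoint (nbhd G (A ∩ Y)) (nbhd G (A \ Y) ∩ Y) := by
      rw [Finset.disjoint_left]
      intro x hx hx'
      obtain ⟨-, u, hu, hux⟩ := mem_nbhd.1 hx
      exact hY.1 (Finset.mem_inter.1 hu).2 (Finset.mem_inter.1 hx').2 hux
    have hsub : nbhd G (A ∩ Y) ∪ (nbhd G (A \ Y) ∩ Y) ⊆ nbhd G A := by
      intro x hx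
      have : ∃ u ∈ A, G.Adj u x := by
        rcases Finset.mem_union.1 hx with hx | hx
        · obtain ⟨-, u, hu, hux⟩ := mem_nbhd.1 hx
          exact ⟨u, (Finset.mem_inter.1 hu).1, hux⟩
        · obtain ⟨-, u, hu, hux⟩ := mem_nbhd.1 (Finset.mem_inter.1 hx).1
          exact ⟨u, (Finset.mem_sdiff.1 hu).1, hux⟩
      obtain ⟨u, hu, hux⟩ := this
      exact mem_nbhd.2 ⟨fun hxA => hA hu hxA hux, u, hu, hux⟩
    have h3 := Finset.card_le_card hsub
    rw [Finset.card_union_of_disjoint hdisj] at h3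
    have := Finset.card_sdiff_add_card_inter A Y
    omega

/-- In a well-covered graph without isolated vertices, every stable set can be matched into its
complement. -/
theorem WellCovered.exists_injOn_adj {G : SimpleGraph V} (hG : WellCovered G)
    (hiso : ∀ v : V, ∃ u, G.Adj v u) {W : Finset V} (hW : IsStable G W) :
    ∃ f : V → V, Set.InjOn f W ∧ ∀ w ∈ W, G.Adj w (f w) := by
  obtain ⟨f, hf, hadj⟩ := (Finset.all_card_le_biUnion_card_iff_exists_injective
    fun w : W => nbhd G {(w : V)}).1 fun s => by
      have hs : IsStable G (s.map (Function.Embedding.subtype _)) :=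
        hW.subset fun x hx => by simp at hx; exact hx.1
      have h := hG.card_le_card_nbhd hiso hs
      rw [Finset.card_map] at h
      refine h.trans (Finset.card_le_card fun x hx => ?_)
      obtain ⟨-, u, hu, hux⟩ := mem_nbhd.1 hx
      obtain ⟨w, hw, rfl⟩ := Finset.mem_map.1 hu
      exact Finset.mem_biUnion.2 ⟨w, hw, mem_nbhd.2
        ⟨fun h => hux.ne (Finset.mem_singleton.1 h).symm, w, by simp, hux⟩⟩
  refine ⟨fun v => if h : v ∈ W then f ⟨v, h⟩ else v, fun x hx y hy hxy => ?_, fun w hw => ?_⟩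
  · have hx : x ∈ W := hx
    have hy : y ∈ W := hy
    simp only [hx, hy, dif_pos] at hxy
    exact congrArg Subtype.val (hf hxy)
  · obtain ⟨-, u, hu, h⟩ := mem_nbhd.1 (hadj ⟨w, hw⟩)
    rw [Finset.mem_singleton.1 hu] at h
    simpa [hw] using h

/-- A stable set meets each edge of a matching at most once. -/
theorem IsStable.card_inter_union_image_le {G : SimpleGraph V} {A Y : Finset V} {f : V → V}
    (hY : IsStable G Y) (hadj : ∀ a ∈ A, G.Adj a (f a)) :
    (Y ∩ (A ∪ A.image f)).card ≤ A.card := by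
  have hsub : Y ∩ (A ∪ A.image f) ⊆ (A ∩ Y) ∪ (A \ Y).image f := by
    intro x hx
    obtain ⟨hxY, hx⟩ := Finset.mem_inter.1 hx
    rcases Finset.mem_union.1 hx with hx | hx
    · exact Finset.mem_union_left _ (Finset.mem_inter.2 ⟨hx, hxY⟩)
    · obtain ⟨a, ha, rfl⟩ := Finset.mem_image.1 hx
      exact Finset.mem_union_right _ (Finset.mem_image_of_mem f
        (Finset.mem_sdiff.2 ⟨ha, fun haY => hY haY hxY (hadj a ha)⟩))
  have h1 := (Finset.card_le_card hsub).trans (Finset.card_union_le _ _)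
  have h2 : ((A \ Y).image f).card ≤ _ := Finset.card_image_le
  have h3 := Finset.card_sdiff_add_card_inter A Y
  omega

/-- In a very well-covered graph, a stable set `S` is a local
maximum stable set iff `|S| = |N(S)|`. -/
theorem mem_psi_iff_card_nbhd_eq (G : SimpleGraph V) (hG : VeryWellCovered G)
    (S : Finset V) (hS : IsStable G S) :
    S ∈ Psi G ↔ S.card = (nbhd G S).card := by
  obtain ⟨hwc, hiso, hV⟩ := hG
  obtain ⟨W, hSW, hW⟩ := hS.exists_isMaximalStable
  obtain ⟨f, hf, hadj⟩ := hwc.exists_injOn_adj hiso hW.1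
  have hWcard := hwc.card_eq_alpha hW
  have himage : S.image f ⊆ nbhd G S := by
    intro x hx
    obtain ⟨s, hs, rfl⟩ := Finset.mem_image.1 hx
    have h := hadj s (hSW hs)
    exact mem_nbhd.2 ⟨fun h' => hS hs h' h, s, hs, h⟩
  have hcard : (S.image f).card = S.card :=
    Finset.card_image_of_injOn (hf.mono (by exact_mod_cast hSW))
  constructor
  · rintro ⟨-, hmax⟩
    rw [← hcard]
    refine congrArg _ (himage.antisymm fun v hv => ?_)
    by_contra hvf
    obtain ⟨Y, hvY, hY⟩ := IsStable.exists_isMaximalStable (G := G) (S := {v})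
      (by simp [IsStable])
    have hvY : v ∈ Y := hvY (Finset.mem_singleton_self v)
    have hYcard := hwc.card_eq_alpha hY
    have hdisj : Disjoint W (W.image f) := by
      rw [Finset.disjoint_left]
      intro x hx hx'
      obtain ⟨w, hw, rfl⟩ := Finset.mem_image.1 hx'
      exact hW.1 hw hx (hadj w hw)
    have huniv : W ∪ W.image f = Finset.univ := by
      rw [← Finset.card_eq_iff_eq_univ, Finset.card_union_of_disjoint hdisj,
        Finset.card_image_of_injOn hf, hV]
      omega
    have hT := hY.1.card_inter_union_image_le (A := W \ S) (f := f)
      fun a ha => hadj a (Finset.mem_sdiff.1 ha).1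
    have hcover : Y ⊆ Y ∩ (S ∪ S.image f) ∪ Y ∩ (W \ S ∪ (W \ S).image f) := by
      intro x hx
      have hxW : x ∈ W ∪ W.image f := huniv ▸ Finset.mem_univ x
      simp only [Finset.mem_union, Finset.mem_inter, Finset.mem_image, Finset.mem_sdiff] at hxW ⊢
      grind
    have h1 := (Finset.card_le_card hcover).trans (Finset.card_union_le _ _)
    have h2 := Finset.card_sdiff_add_card_eq_card hSW
    have h3 : (insert v (Y ∩ (S ∪ S.image f))).card ≤ alphaOn G (closedNbhd G S) := by
      refine (hY.1.subset ?_).card_le_alphaOn ?_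
      · exact Finset.insert_subset hvY Finset.inter_subset_left
      · exact Finset.insert_subset (Finset.mem_union_right _ hv)
          (Finset.inter_subset_right.trans (Finset.union_subset_union_right himage))
    rw [Finset.card_insert_of_notMem] at h3
    · omega
    · have := (mem_nbhd.1 hv).1
      simp only [Finset.mem_inter, Finset.mem_union]
      tauto
  · intro h
    refine ⟨hS, (hS.card_le_alphaOn
      (A := closedNbhd G S) Finset.subset_union_left).antisymm ?_⟩
    obtain ⟨T, hTsub, hT, hTcard⟩ := exists_isStable_card_eq_alphaOn G (closedNbhd G S)
    rw [closedNbhd, ← Finset.eq_of_subset_of_card_le himage (by omega)] at hTsub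
    rw [← hTcard, ← Finset.inter_eq_left.2 hTsub]
    exact hT.card_inter_union_image_le fun a ha => hadj a (hSW ha)
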